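/- arXiv:math/0604105 — 2 statements merged into one kernel-verified Lean document; each statement's English description precedes it below -/
import Mathlib

section
/- Let Γ be an inverse semigroup with zero and let x, y ∈ Γ be minimal elements. Then the following are equivalent: (i) x·y ≠ 0; (ii) x⁻¹·x = y·y⁻¹; (iii) x·y is minimal. -/
/-- An inverse semigroup: a semigroup in which every element `x` has a unique
element `x⁻¹` with `x * x⁻¹ * x = x` and `x⁻¹ * x * x⁻¹ = x⁻¹`. -/
class InverseSemigroup (α : Type*) extends Semigroup α, Inv α where
  mul_inv_mul : ∀ x : α, x * x⁻¹ * x = x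
  inv_mul_inv : ∀ x : α, x⁻¹ * x * x⁻¹ = x⁻¹
  inv_unique : ∀ x y : α, x * y * x = x → y * x * y = y → y = x⁻¹

variable {α : Type*} [InverseSemigroup α]

/-- The natural order on an inverse semigroup: `x ≺ y` iff `x * y⁻¹ = x * x⁻¹`. -/
def prec (x y : α) : Prop := x * y⁻¹ = x * x⁻¹

/-- The idempotents (units) `Γ⁽⁰⁾`: elements `p` with `p = p * p⁻¹`. -/
def IsIdem (p : α) : Prop := p = p * p⁻¹

/-- A zero element: `z * x = z = x * z` for every `x`. -/
def IsZeroEl (z : α) : Prop := ∀ x : α, z * x = z ∧ x * z = z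


/-- An element is minimal (w.r.t. the zero z) if it is not zero and every
nonzero precessor of it equals it. -/
def IsMinimalEl (z x : α) : Prop := x ≠ z ∧ ∀ y : α, prec y x → y ≠ z → y = x

namespace InverseSemigroup

theorem inv_eq_of_mul_self {e : α} (he : e * e = e) : e⁻¹ = e :=
  (inv_unique e e (by rw [he, he]) (by rw [he, he])).symm

theorem inv_inv_eq (x : α) : x⁻¹⁻¹ = x :=
  (inv_unique x⁻¹ x (inv_mul_inv x) (mul_inv_mul x)).symm

theorem mul_inv_mul_self (x : α) : (x * x⁻¹) * (x * x⁻¹) = x * x⁻¹ := by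
  rw [← mul_assoc, mul_inv_mul]

theorem inv_mul_mul_self (x : α) : (x⁻¹ * x) * (x⁻¹ * x) = x⁻¹ * x := by
  rw [← mul_assoc, inv_mul_inv]

theorem mul_mul_self_of_idem {e f : α} (he : e * e = e) (hf : f * f = f) :
    (e * f) * (e * f) = e * f := by
  have he' (t : α) : e * (e * t) = e * t := by rw [← mul_assoc, he]
  have hf' (t : α) : f * (f * t) = f * t := by rw [← mul_assoc, hf]
  have h1 : e * (f * ((e * f)⁻¹ * (e * f))) = e * f := by
    simpa only [mul_assoc] using mul_inv_mul (e * f)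
  have h2 (t : α) : (e * f)⁻¹ * (e * (f * ((e * f)⁻¹ * t))) = (e * f)⁻¹ * t := by
    simpa only [mul_assoc] using congrArg (· * t) (inv_mul_inv (e * f))
  have ha : f * ((e * f)⁻¹ * e) = (e * f)⁻¹ := by
    apply inv_unique
    · simp only [mul_assoc, he', hf', h1]
    · simp only [mul_assoc, he', hf', h2]
  have hidem : (e * f)⁻¹ * (e * f)⁻¹ = (e * f)⁻¹ := by
    nth_rw 1 [← ha]
    nth_rw 2 [← ha]
    simp only [mul_assoc, h2]
    exact ha
  have hinv : (e * f)⁻¹ = e * f := by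
    rw [← inv_eq_of_mul_self hidem, inv_inv_eq]
  rwa [hinv] at hidem

theorem mul_comm_of_idem {e f : α} (he : e * e = e) (hf : f * f = f) : e * f = f * e := by
  have he' (t : α) : e * (e * t) = e * t := by rw [← mul_assoc, he]
  have hf' (t : α) : f * (f * t) = f * t := by rw [← mul_assoc, hf]
  have hef := mul_mul_self_of_idem he hf
  have hfe := mul_mul_self_of_idem hf he
  rw [← inv_eq_of_mul_self hef]
  refine (inv_unique _ _ ?_ ?_).symm
  · simpa only [mul_assoc, he', hf'] using hef
  · simpa only [mul_assoc, he', hf'] using hfe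

theorem mul_inv_rev_eq (x y : α) : (x * y)⁻¹ = y⁻¹ * x⁻¹ := by
  have hc := mul_comm_of_idem (mul_inv_mul_self y) (inv_mul_mul_self x)
  refine (inv_unique _ _ ?_ ?_).symm
  · calc x * y * (y⁻¹ * x⁻¹) * (x * y) = x * ((y * y⁻¹) * (x⁻¹ * x)) * y := by
          simp only [mul_assoc]
      _ = (x * x⁻¹ * x) * (y * y⁻¹ * y) := by rw [hc]; simp only [mul_assoc]
      _ = x * y := by rw [mul_inv_mul, mul_inv_mul]
  · calc y⁻¹ * x⁻¹ * (x * y) * (y⁻¹ * x⁻¹) = y⁻¹ * ((x⁻¹ * x) * (y * y⁻¹)) * x⁻¹ := by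
          simp only [mul_assoc]
      _ = (y⁻¹ * y * y⁻¹) * (x⁻¹ * x * x⁻¹) := by rw [← hc]; simp only [mul_assoc]
      _ = y⁻¹ * x⁻¹ := by rw [inv_mul_inv, inv_mul_inv]

theorem prec_mul_right {f : α} (hf : f * f = f) (x : α) : prec (x * f) x := by
  unfold prec
  rw [mul_inv_rev_eq, inv_eq_of_mul_self hf, mul_assoc x f (f * x⁻¹), ← mul_assoc f f, hf,
    mul_assoc]

theorem prec_mul_left {e : α} (he : e * e = e) (x : α) : prec (e * x) x := by
  unfold prec
  rw [mul_inv_rev_eq, inv_eq_of_mul_self he, mul_assoc e x (x⁻¹ * e), ← mul_assoc x x⁻¹ e,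
    ← mul_comm_of_idem he (mul_inv_mul_self x), ← mul_assoc e e, he, mul_assoc]

theorem eq_mul_of_prec {w x : α} (h : prec w x) : x * (w⁻¹ * w) = w := by
  have h' := congrArg (·⁻¹) (show w * x⁻¹ = w * w⁻¹ from h)
  simp only [mul_inv_rev_eq, inv_inv_eq] at h'
  rw [← mul_assoc, h', mul_inv_mul]

end InverseSemigroup

open InverseSemigroup

/-- for minimal x, y in an inverse semigroup with zero, TFAE:
(i) x·y ≠ 0; (ii) x⁻¹·x = y·y⁻¹; (iii) x·y minimal. -/
theorem stmt3 {z : α} (hz : IsZeroEl z) {x y : α}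
    (hx : IsMinimalEl z x) (hy : IsMinimalEl z y) :
    List.TFAE [x * y ≠ z, x⁻¹ * x = y * y⁻¹, IsMinimalEl z (x * y)] := by
  tfae_have 1 → 2 := by
    intro h
    have hxe : x * (y * y⁻¹) = x := by
      refine hx.2 _ (prec_mul_right (mul_inv_mul_self y) x) fun h0 => h ?_
      calc x * y = x * (y * y⁻¹) * y := by rw [mul_assoc, mul_inv_mul]
        _ = z := by rw [h0, (hz y).1]
    have hey : x⁻¹ * x * y = y := by
      refine hy.2 _ (prec_mul_left (inv_mul_mul_self x) y) fun h0 => h ?_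
      calc x * y = x * (x⁻¹ * x * y) := by rw [← mul_assoc, ← mul_assoc, mul_inv_mul]
        _ = z := by rw [h0, (hz x).2]
    calc x⁻¹ * x = x⁻¹ * (x * (y * y⁻¹)) := by rw [hxe]
      _ = x⁻¹ * x * y * y⁻¹ := by simp only [mul_assoc]
      _ = y * y⁻¹ := by rw [hey]
  tfae_have 2 → 3 := by
    intro h
    refine ⟨fun h0 => hx.1 ?_, fun w hw hw0 => ?_⟩
    · calc x = x * y * y⁻¹ := by rw [mul_assoc, ← h, ← mul_assoc, mul_inv_mul]
        _ = z := by rw [h0, (hz _).1]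
    · have hxyw := eq_mul_of_prec hw
      rw [mul_assoc] at hxyw
      have hyw : y * (w⁻¹ * w) = y := by
        refine hy.2 _ (prec_mul_right (inv_mul_mul_self w) y) fun h0 => hw0 ?_
        rw [← hxyw, h0, (hz x).2]
      rw [← hxyw, hyw]
  tfae_have 3 → 1 := fun h => h.1
  tfae_finish
end

section
/- Let Γ be an inverse semigroup with zero satisfying condition (L), and let x, x₁, …, xₙ ∈ Γ. Then the following are equivalent: (i) x < (x₁,…,xₙ); (ii) for every maximal zero-free directed set B ⊆ Γ (i.e. B directed, 0 ∉ B, and the only directed set C with B ⊆ C and 0 ∉ C is B itself) such that some b ∈ B satisfies b ≺ x, there exist j ∈ {1,…,n} and b' ∈ B with b' ≺ x_j. (This is the inclusion criterion V_x ⊆ V_{x₁} ∪ … ∪ V_{xₙ} for the basic sets of the groupoid G_m(Γ) of minimal elements, whose points correspond to maximal zero-free directed subsets of Γ.) -/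
variable {α : Type*} [InverseSemigroup α]

/-- A subset A is directed if any two of its elements have a common
precessor in A. -/
def IsDirectedSet (A : Set α) : Prop :=
  ∀ a ∈ A, ∀ b ∈ A, ∃ c ∈ A, prec c a ∧ prec c b

/-- Elementwise product of two subsets. -/
def mulSet (A B : Set α) : Set α := {x | ∃ a ∈ A, ∃ b ∈ B, x = a * b}

/-- Elementwise inverse of a subset. -/
def invSet (A : Set α) : Set α := {x | ∃ a ∈ A, x = a⁻¹}

/-- A ≼ B iff every b ∈ B has some a ∈ A with a ≺ b. -/
def sprec (A B : Set α) : Prop := ∀ b ∈ B, ∃ a ∈ A, prec a b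

/-- A ∼ B iff A ≼ B and B ≼ A. -/
def sequiv (A B : Set α) : Prop := sprec A B ∧ sprec B A


/-- The relation x < (x₁,…,xₙ) (w.r.t. the zero z0), with the finite family
given as a finset: every nonzero precessor of x has a nonzero common precessor
with some member of s. -/
def ltS (z0 x : α) (s : Finset α) : Prop :=
  ∀ y : α, prec y x → y ≠ z0 → ∃ t ∈ s, ∃ w : α, w ≠ z0 ∧ prec w y ∧ prec w t


/-- A maximal zero-free directed set: directed, avoiding the zero, and maximal
among directed sets avoiding the zero. -/
def MaxZeroFree (z0 : α) (B : Set α) : Prop :=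
  IsDirectedSet B ∧ z0 ∉ B ∧
    ∀ C : Set α, IsDirectedSet C → B ⊆ C → z0 ∉ C → C = B


theorem mul_self_eq_self_of_idem {e f : α} (he : e * e = e) (hf : f * f = f) :
    e * f * (e * f) = e * f := by
  have h1 := InverseSemigroup.mul_inv_mul (e * f)
  have h2 := InverseSemigroup.inv_mul_inv (e * f)
  have hu := InverseSemigroup.inv_unique (e * f)
  generalize (e * f)⁻¹ = a at h1 h2 hu
  have he' : ∀ u : α, e * (e * u) = e * u := fun u => by rw [← mul_assoc, he]
  have hf' : ∀ u : α, f * (f * u) = f * u := fun u => by rw [← mul_assoc, hf]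
  have h2' : ∀ u : α, a * (e * (f * (a * u))) = a * u := fun u => by
    simpa only [mul_assoc] using congrArg (· * u) h2
  have ha : f * a * e = a := by
    apply hu
    · simpa only [mul_assoc, he', hf'] using h1
    · simp only [mul_assoc, he', hf', h2']
  have haa : a * a = a := by
    calc a * a = f * a * e * (f * a * e) := by rw [ha]
      _ = f * a * e := by simp only [mul_assoc, h2']
      _ = a := ha
  have hself : a = a⁻¹ := InverseSemigroup.inv_unique a a (by rw [haa, haa]) (by rw [haa, haa])
  have hef : e * f = a⁻¹ := InverseSemigroup.inv_unique a (e * f) h2 h1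
  rw [hef, ← hself, haa]

theorem idem_mul_comm {e f : α} (he : e * e = e) (hf : f * f = f) : e * f = f * e := by
  have hef := mul_self_eq_self_of_idem he hf
  have hfe := mul_self_eq_self_of_idem hf he
  have he' : ∀ u : α, e * (e * u) = e * u := fun u => by rw [← mul_assoc, he]
  have hf' : ∀ u : α, f * (f * u) = f * u := fun u => by rw [← mul_assoc, hf]
  rw [InverseSemigroup.inv_unique (e * f) (e * f) (by rw [hef, hef]) (by rw [hef, hef])]
  refine (InverseSemigroup.inv_unique (e * f) (f * e) ?_ ?_).symm
  · simpa only [mul_assoc, he', hf'] using hef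
  · simpa only [mul_assoc, he', hf'] using hfe

theorem mul_inv_idem (x : α) : x * x⁻¹ * (x * x⁻¹) = x * x⁻¹ := by
  rw [← mul_assoc, InverseSemigroup.mul_inv_mul]

theorem inv_mul_idem (x : α) : x⁻¹ * x * (x⁻¹ * x) = x⁻¹ * x := by
  rw [← mul_assoc, InverseSemigroup.inv_mul_inv]

theorem inverseSemigroup_inv_inv (x : α) : x⁻¹⁻¹ = x :=
  (InverseSemigroup.inv_unique x⁻¹ x (InverseSemigroup.inv_mul_inv x)
    (InverseSemigroup.mul_inv_mul x)).symm

theorem inverseSemigroup_mul_inv_rev (x y : α) : (x * y)⁻¹ = y⁻¹ * x⁻¹ := by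
  have hc := idem_mul_comm (inv_mul_idem x) (mul_inv_idem y)
  refine (InverseSemigroup.inv_unique (x * y) (y⁻¹ * x⁻¹) ?_ ?_).symm
  · calc x * y * (y⁻¹ * x⁻¹) * (x * y) = x * (y * y⁻¹ * (x⁻¹ * x)) * y := by
          simp only [mul_assoc]
      _ = x * x⁻¹ * x * (y * y⁻¹ * y) := by rw [← hc]; simp only [mul_assoc]
      _ = x * y := by simp only [InverseSemigroup.mul_inv_mul]
  · calc y⁻¹ * x⁻¹ * (x * y) * (y⁻¹ * x⁻¹) = y⁻¹ * (x⁻¹ * x * (y * y⁻¹)) * x⁻¹ := by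
          simp only [mul_assoc]
      _ = y⁻¹ * y * y⁻¹ * (x⁻¹ * x * x⁻¹) := by rw [hc]; simp only [mul_assoc]
      _ = y⁻¹ * x⁻¹ := by simp only [InverseSemigroup.inv_mul_inv]

theorem prec_refl (x : α) : prec x x := rfl

theorem prec.mul_inv_mul_eq {x y : α} (h : prec x y) : x * y⁻¹ * y = x := by
  have h : x * y⁻¹ = x * x⁻¹ := h
  have h' : y * x⁻¹ = x * x⁻¹ := by
    have := congrArg (·⁻¹) h
    simpa only [inverseSemigroup_mul_inv_rev, inverseSemigroup_inv_inv] using this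
  have hc := idem_mul_comm (inv_mul_idem x) (inv_mul_idem y)
  calc x * y⁻¹ * y = x * x⁻¹ * x * y⁻¹ * y := by rw [InverseSemigroup.mul_inv_mul]
    _ = x * (x⁻¹ * x * (y⁻¹ * y)) := by simp only [mul_assoc]
    _ = x * y⁻¹ * (y * x⁻¹) * x := by rw [hc]; simp only [mul_assoc]
    _ = x := by rw [h', h, mul_inv_idem, InverseSemigroup.mul_inv_mul]

theorem prec.trans {x y z : α} (hxy : prec x y) (hyz : prec y z) : prec x z := by
  have hyz : y * z⁻¹ = y * y⁻¹ := hyz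
  calc x * z⁻¹ = x * y⁻¹ * (y * z⁻¹) := by rw [← mul_assoc, hxy.mul_inv_mul_eq]
    _ = x * y⁻¹ := by rw [hyz, ← mul_assoc, hxy.mul_inv_mul_eq]
    _ = x * x⁻¹ := hxy

theorem prec.eq_zero {z0 x : α} (hz : IsZeroEl z0) (h : prec x z0) : x = z0 := by
  rw [← h.mul_inv_mul_eq, (hz _).2]

theorem exists_maxZeroFree_mem {z0 y : α} (hy : y ≠ z0) :
    ∃ B : Set α, MaxZeroFree z0 B ∧ y ∈ B := by
  obtain ⟨B, hyB, hB⟩ := zorn_subset_nonempty {C : Set α | IsDirectedSet C ∧ z0 ∉ C}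
    (fun c hc hchain _ => by
      refine ⟨⋃₀ c, ⟨?_, ?_⟩, fun _ hs => Set.subset_sUnion_of_mem hs⟩
      · rintro a ⟨A, hA, ha⟩ b ⟨A', hA', hb⟩
        rcases hchain.total hA hA' with hle | hle
        · obtain ⟨d, hd, h⟩ := (hc hA').1 a (hle ha) b hb
          exact ⟨d, ⟨A', hA', hd⟩, h⟩
        · obtain ⟨d, hd, h⟩ := (hc hA).1 a ha b (hle hb)
          exact ⟨d, ⟨A, hA, hd⟩, h⟩
      · rintro ⟨A, hA, h⟩
        exact (hc hA).2 h)
    {y} ⟨fun a ha b hb => ⟨y, rfl, by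
      rw [Set.mem_singleton_iff.1 ha, Set.mem_singleton_iff.1 hb]
      exact ⟨prec_refl y, prec_refl y⟩⟩, fun h => hy h.symm⟩
  exact ⟨B, ⟨hB.prop.1, hB.prop.2, fun C hC hBC h0 => (hB.eq_of_subset ⟨hC, h0⟩ hBC).symm⟩,
    hyB rfl⟩

/-- A maximal zero-free directed set contains every element having a nonzero
common precessor with each of its members. -/
theorem MaxZeroFree.mem_of_forall_common {z0 : α} (hz : IsZeroEl z0)
    (hL : ∀ a b : α, (∃ v : α, v ≠ z0 ∧ prec v a ∧ prec v b) →
      ∃ w : α, prec w a ∧ prec w b ∧ ∀ v : α, prec v a → prec v b → prec v w)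
    {B : Set α} (hB : MaxZeroFree z0 B) {b₀ : α} (hb₀ : b₀ ∈ B) {t : α}
    (ht : ∀ b ∈ B, ∃ v : α, v ≠ z0 ∧ prec v b ∧ prec v t) : t ∈ B := by
  rw [← hB.2.2 {c | ∃ b ∈ B, ∀ v, prec v b → prec v t → prec v c} ?_
    (fun b hb => ⟨b, hb, fun _ h _ => h⟩) ?_]
  · exact ⟨b₀, hb₀, fun _ _ h => h⟩
  · rintro c₁ ⟨b₁, hb₁, h₁⟩ c₂ ⟨b₂, hb₂, h₂⟩
    obtain ⟨b, hb, hbb₁, hbb₂⟩ := hB.1 b₁ hb₁ b₂ hb₂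
    obtain ⟨w, hwb, hwt, hw⟩ := hL b t (ht b hb)
    exact ⟨w, ⟨b, hb, hw⟩, h₁ w (hwb.trans hbb₁) hwt, h₂ w (hwb.trans hbb₂) hwt⟩
  · rintro ⟨b, hb, h⟩
    obtain ⟨v, hv, hvb, hvt⟩ := ht b hb
    exact hv ((h v hvb hvt).eq_zero hz)

/-- A directed set contains lower bounds for finite families of its members. -/
theorem IsDirectedSet.exists_forall_prec {ι : Type*} {B : Set α} (hB : IsDirectedSet B)
    {b : α} (hb : b ∈ B) (s : Finset ι) (f : ι → α) (hf : ∀ i ∈ s, f i ∈ B) :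
    ∃ c ∈ B, prec c b ∧ ∀ i ∈ s, prec c (f i) := by
  classical
  induction s using Finset.induction_on with
  | empty => exact ⟨b, hb, prec_refl b, by simp⟩
  | insert i s _ ih =>
    obtain ⟨c, hc, hcb, hcs⟩ := ih fun j hj => hf j (Finset.mem_insert_of_mem hj)
    obtain ⟨d, hd, hdc, hdi⟩ := hB c hc (f i) (hf i (Finset.mem_insert_self i s))
    refine ⟨d, hd, hdc.trans hcb, fun j hj => ?_⟩
    rcases Finset.mem_insert.1 hj with rfl | hj
    · exact hdi
    · exact hdc.trans (hcs j hj)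

/-- for Γ with zero satisfying condition (L), x < (x₁,…,xₙ) iff
every maximal zero-free directed set B meeting {b : b ≺ x} meets
{b : b ≺ xⱼ} for some j, i.e. V_x ⊆ V_{x₁} ∪ … ∪ V_{xₙ}. -/
theorem stmt17 {z0 : α} (hz : IsZeroEl z0)
    (hL : ∀ a b : α, (∃ v : α, v ≠ z0 ∧ prec v a ∧ prec v b) →
      ∃ w : α, prec w a ∧ prec w b ∧ ∀ v : α, prec v a → prec v b → prec v w)
    (x : α) (s : Finset α) :
    ltS z0 x s ↔
      ∀ B : Set α, MaxZeroFree z0 B → (∃ b ∈ B, prec b x) →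
        ∃ t ∈ s, ∃ b ∈ B, prec b t := by
  constructor
  · rintro hlt B hB ⟨b, hb, hbx⟩
    by_contra! hno
    have hsep : ∀ t : α, ∃ d : α, t ∈ s →
        d ∈ B ∧ ∀ v, v ≠ z0 → prec v d → ¬ prec v t := by
      intro t
      by_contra! h
      have hts : t ∈ s := (h b).1
      refine hno t hts t (hB.mem_of_forall_common hz hL hb fun d hd => ?_) (prec_refl t)
      exact (h d).2 hd
    choose f hf using hsep
    obtain ⟨c, hc, hcb, hcs⟩ := hB.1.exists_forall_prec hb s f fun t ht => (hf t ht).1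
    obtain ⟨t, ht, w, hw, hwc, hwt⟩ := hlt c (hcb.trans hbx) fun h => hB.2.1 (h ▸ hc)
    exact (hf t ht).2 w hw (hwc.trans (hcs t ht)) hwt
  · intro h y hyx hy
    obtain ⟨B, hB, hyB⟩ := exists_maxZeroFree_mem hy
    obtain ⟨t, ht, b, hb, hbt⟩ := h B hB ⟨y, hyB, hyx⟩
    obtain ⟨c, hc, hcy, hcb⟩ := hB.1 y hyB b hb
    exact ⟨t, ht, c, fun h0 => hB.2.1 (h0 ▸ hc), hcy, hcb.trans hbt⟩
end
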